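/- Let X = Y ∘ T₄, a configuration of 173 segments. There is no realization of X by segments with all endpoints on the parabola y = x² such that simultaneously: (i) in each of the 15 whiskers, the three segments a, b, c intersect concavely; (ii) in each of the 16 copies of Y, the three segments d, e, f intersect concavely; and (iii) in each of the 16 groups of numeric segments, the five numeric segments intersect concavely. -/

import Mathlib

/-! ### Sequences with special blocks, encoded as token lists

A sequence with special blocks is encoded as a list of tokens: `Tok.sym a` is an
occurrence of the symbol `a`, and `Tok.op` / `Tok.cl` are the opening and closing
parentheses delimiting the special blocks. -/

/-- Tokens of a symbol sequence with special blocks. -/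
inductive Tok : Type where
  | sym : ℕ → Tok
  | op : Tok
  | cl : Tok
deriving DecidableEq, Repr

/-- Tokens of an endpoint sequence with special blocks: `L a` / `R a` are the
left/right endpoint letters of the symbol `a`, and `op`/`cl` delimit blocks. -/
inductive ETok : Type where
  | L : ℕ → ETok
  | R : ℕ → ETok
  | op : ETok
  | cl : ETok
deriving DecidableEq, Repr

/-- Fresh relabeling of the symbols of the `i`-th local copy. -/
def loc (i a : ℕ) : ℕ := 2 * Nat.pair i a

/-- Relabeling of the global symbols. -/
def glob (a : ℕ) : ℕ := 2 * a + 1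

/-- The underlying sequence of symbols of a token list (parentheses dropped). -/
def symsOf : List Tok → List ℕ
  | [] => []
  | Tok.sym a :: r => a :: symsOf r
  | _ :: r => symsOf r

/-- Read a special block: the symbols up to (and excluding) the next closing
parenthesis, together with the remainder of the list after that parenthesis. -/
def takeBlock : List Tok → List ℕ × List Tok
  | [] => ([], [])
  | Tok.cl :: r => ([], r)
  | Tok.sym a :: r => ((takeBlock r).1.cons a, (takeBlock r).2)
  | Tok.op :: r => takeBlock r

theorem takeBlock_len : ∀ l : List Tok, (takeBlock l).2.length ≤ l.length := by
  intro l
  induction l with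
  | nil => simp [takeBlock]
  | cons t r ih => cases t <;> simp [takeBlock] <;> omega

/-- Auxiliary function for the shuffle `A • B`: traverse the `i`-th fresh copy of
`A` (relabeling its symbols by `loc i`), inserting the next global symbol of the
list `ins` (relabeled by `glob`) at the end of each special block and duplicating
the previously last symbol of that block immediately after the block.  The third
argument remembers the (relabeled) last symbol seen. -/
def copyIns (i : ℕ) : List Tok → List ℕ → Option ℕ → List Tok
  | [], _, _ => []
  | Tok.sym a :: r, ins, _ => Tok.sym (loc i a) :: copyIns i r ins (some (loc i a))
  | Tok.op :: r, ins, p => Tok.op :: copyIns i r ins p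
  | Tok.cl :: r, b :: ins, some q =>
      Tok.sym (glob b) :: Tok.cl :: Tok.sym q :: copyIns i r ins (some q)
  | Tok.cl :: r, ins, p => Tok.cl :: copyIns i r ins p

/-- The modified copy `Aᵢ'` of `A` used in the shuffle `A • B`: the symbols of the
`i`-th special block `blk` of `B` are inserted into the special blocks of the copy,
and another copy of the last symbol of `blk` is appended at the very end. -/
def copyA (i : ℕ) (A : List Tok) (blk : List ℕ) : List Tok :=
  copyIns i A blk none ++ (blk.getLast?.elim [] fun a => [Tok.sym (glob a)])

/-- Auxiliary function for the shuffle: traverse `B` (relabeling its symbols by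
`glob`), replacing its `i`-th special block by the modified `i`-th copy of `A`. -/
def bulletAux (A : List Tok) : ℕ → List Tok → List Tok
  | _, [] => []
  | i, Tok.op :: r => copyA i A (takeBlock r).1 ++ bulletAux A (i + 1) (takeBlock r).2
  | i, Tok.sym a :: r => Tok.sym (glob a) :: bulletAux A i r
  | i, Tok.cl :: r => Tok.cl :: bulletAux A i r
termination_by _ l => l.length
decreasing_by
  · exact Nat.lt_succ_of_le (takeBlock_len r)
  · exact Nat.lt_succ_self _
  · exact Nat.lt_succ_self _

/-- The shuffle `A • B` of two sequences with special blocks. -/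
def bullet (A B : List Tok) : List Tok := bulletAux A 0 B

/-- Split each special block of length 2 into two special blocks of length 1. -/
def split2 : List Tok → List Tok
  | Tok.op :: Tok.sym a :: Tok.sym b :: Tok.cl :: r =>
      Tok.op :: Tok.sym a :: Tok.cl :: Tok.op :: Tok.sym b :: Tok.cl :: split2 r
  | t :: r => t :: split2 r
  | [] => []

/-- The Hart–Sharir sequence `S₁(m) = (1 2 ⋯ m) (m−1) ⋯ 2 1 2 ⋯ m`,
with a single special block `(1 2 ⋯ m)`. -/
def S1 (m : ℕ) : List Tok :=
  Tok.op :: ((List.range' 1 m).map Tok.sym) ++ Tok.cl ::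
    (((List.range' 1 (m - 1)).reverse.map Tok.sym) ++ ((List.range' 2 (m - 1)).map Tok.sym))

/-- The number of special blocks of a token sequence. -/
def numBlocks (S : List Tok) : ℕ := S.count Tok.op

/-- The Hart–Sharir sequences `S_k(m)`, defined by double recursion:
`S₁(m)` is the `N`-shaped sequence above; for `k ≥ 2`, `S_k(1)` is `S_{k−1}(2)` with
each special block of length 2 split into two special blocks of length 1; and for
`k, m ≥ 2`, `S_k(m) = S_k(m−1) • S_{k−1}(N)` where `N` is the number of special
blocks of `S_k(m−1)`.  (The value for `k = 0` or `m = 0` is junk.) -/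
def HS : ℕ → ℕ → List Tok
  | 0, _ => []
  | 1, m => S1 m
  | _ + 2, 0 => []
  | k + 2, 1 => split2 (HS (k + 1) 2)
  | k + 2, m + 2 => bullet (HS (k + 2) (m + 1)) (HS (k + 1) (numBlocks (HS (k + 2) (m + 1))))
termination_by k m => (k, m)



/-- The list of special blocks of a token sequence (each block as its list of symbols). -/
def blocksOf : List Tok → List (List ℕ)
  | [] => []
  | Tok.op :: r => (takeBlock r).1 :: blocksOf (takeBlock r).2
  | _ :: r => blocksOf r
termination_by l => l.length
decreasing_by
  · exact Nat.lt_succ_of_le (takeBlock_len r)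
  · exact Nat.lt_succ_self _

/-- The rank of a symbol: the position (counting from 1) that its first occurrence
occupies within its special block (`0` if the symbol lies in no special block). -/
def rankOf (S : List Tok) (a : ℕ) : ℕ :=
  match (blocksOf S).find? (fun b => decide (a ∈ b)) with
  | some b => b.idxOf a + 1
  | none => 0

/-- Two symbols have their first occurrences in the same special block. -/
def SameBlock (S : List Tok) (a b : ℕ) : Prop :=
  ∃ blk ∈ blocksOf S, a ∈ blk ∧ b ∈ blk

/-- The symbol `a` is left-clamped in the sequence `s`: `s` contains the
subsequence `b a b a`, where `b` is the symbol immediately preceding the first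
occurrence of `a` in `s`. -/
def LeftClamped (s : List ℕ) (a : ℕ) : Prop :=
  ∃ (u v : List ℕ) (b : ℕ), s = u ++ b :: a :: v ∧ a ∉ u ∧ b ≠ a ∧
    [b, a, b, a].Sublist s

/-- The symbol `a` is right-clamped in the sequence `s`: `s` contains the
subsequence `a b a b`, where `b` is the symbol immediately following the last
occurrence of `a` in `s`. -/
def RightClamped (s : List ℕ) (a : ℕ) : Prop :=
  ∃ (u v : List ℕ) (b : ℕ), s = u ++ a :: b :: v ∧ a ∉ v ∧ b ≠ a ∧
    [a, b, a, b].Sublist s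

/-- Auxiliary function for the endpoint sequence: the first argument collects the
symbols already seen.  The first occurrence of each symbol becomes an `L` letter,
its last occurrence becomes an `R` letter, all other occurrences are deleted, and
parentheses are kept. -/
def EAux : List ℕ → List Tok → List ETok
  | _, [] => []
  | seen, Tok.op :: r => ETok.op :: EAux seen r
  | seen, Tok.cl :: r => ETok.cl :: EAux seen r
  | seen, Tok.sym a :: r =>
      if a ∈ seen then
        if a ∈ symsOf r then EAux seen r else ETok.R a :: EAux seen r
      else ETok.L a :: EAux (a :: seen) r

/-- The endpoint sequence `E(S)` of a sequence with special blocks. -/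
def Efun (S : List Tok) : List ETok := EAux [] S

/-- Read a special block of an endpoint sequence: the labels of the `L` letters up
to the next closing parenthesis, and the remainder of the list after it. -/
def takeBlockE : List ETok → List ℕ × List ETok
  | [] => ([], [])
  | ETok.cl :: r => ([], r)
  | ETok.L a :: r => ((takeBlockE r).1.cons a, (takeBlockE r).2)
  | _ :: r => takeBlockE r

theorem takeBlockE_len : ∀ l : List ETok, (takeBlockE l).2.length ≤ l.length := by
  intro l
  induction l with
  | nil => simp [takeBlockE]
  | cons t r ih => cases t <;> simp [takeBlockE] <;> omega

/-- Auxiliary function for the endpoint shuffle `A ∘ B`: traverse the `i`-th fresh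
copy of `A` (relabeling by `loc i`), inserting the next left-endpoint letter of the
list `ins` (relabeled by `glob`) at the end of each special block. -/
def ecopyIns (i : ℕ) : List ETok → List ℕ → List ETok
  | [], _ => []
  | ETok.L a :: r, ins => ETok.L (loc i a) :: ecopyIns i r ins
  | ETok.R a :: r, ins => ETok.R (loc i a) :: ecopyIns i r ins
  | ETok.op :: r, ins => ETok.op :: ecopyIns i r ins
  | ETok.cl :: r, b :: ins => ETok.L (glob b) :: ETok.cl :: ecopyIns i r ins
  | ETok.cl :: r, [] => ETok.cl :: ecopyIns i r []

/-- Auxiliary function for the endpoint shuffle: traverse `B` (relabeling by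
`glob`), replacing its `i`-th special block by the `i`-th modified copy of `A`. -/
def eshufAux (A : List ETok) : ℕ → List ETok → List ETok
  | _, [] => []
  | i, ETok.op :: r => ecopyIns i A (takeBlockE r).1 ++ eshufAux A (i + 1) (takeBlockE r).2
  | i, ETok.L a :: r => ETok.L (glob a) :: eshufAux A i r
  | i, ETok.R a :: r => ETok.R (glob a) :: eshufAux A i r
  | i, ETok.cl :: r => ETok.cl :: eshufAux A i r
termination_by _ l => l.length
decreasing_by
  · exact Nat.lt_succ_of_le (takeBlockE_len r)
  · exact Nat.lt_succ_self _
  · exact Nat.lt_succ_self _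
  · exact Nat.lt_succ_self _

/-- The endpoint shuffle `A ∘ B` of two endpoint sequences with special blocks. -/
def eshuffle (A B : List ETok) : List ETok := eshufAux A 0 B

/-- The token list is a well-formed sequence with special blocks: a concatenation
of symbols and of parenthesized blocks consisting only of symbols. -/
inductive Blocked : List Tok → Prop
  | nil : Blocked []
  | sym (a : ℕ) {l : List Tok} : Blocked l → Blocked (Tok.sym a :: l)
  | blk (b : List ℕ) {l : List Tok} :
      Blocked l → Blocked (Tok.op :: b.map Tok.sym ++ Tok.cl :: l)

/-- The special blocks of `S` contain only first occurrences of symbols, and every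
symbol of `S` makes its first occurrence inside a special block. -/
def FirstOccBlocks (S : List Tok) : Prop :=
  (∀ (u b v : List Tok), S = u ++ Tok.op :: b ++ Tok.cl :: v →
      ∀ a : ℕ, Tok.sym a ∈ b → a ∉ symsOf u ∧ (symsOf b).count a = 1) ∧
  (∀ a ∈ symsOf S, ∃ (u b v : List Tok),
      S = u ++ Tok.op :: b ++ Tok.cl :: v ∧ Tok.sym a ∈ b ∧ a ∉ symsOf u)

/-! ### Geometry of the parabola -/

/-- The point of the parabola `y = x²` with x-coordinate `t`. -/
noncomputable def Ppt (t : ℝ) : ℝ × ℝ := (t, t ^ 2)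

/-- The closed straight-line segment between the points of the parabola with
x-coordinates `a` and `b`. -/
noncomputable def Seg (a b : ℝ) : Set (ℝ × ℝ) := segment ℝ (Ppt a) (Ppt b)

/-- Given left and right endpoint x-coordinates `xL`, `xR` for the segments named
by labels, the segments named by the list `ls = [s₁, …, sₘ]` intersect concavely:
for each three consecutive members, the intersection point `s_{k+2} ∩ s_{k+1}` lies
strictly to the left of the intersection point `s_{k+1} ∩ s_k`; that is, the
intersection points `sₘ ∩ sₘ₋₁, …, s₂ ∩ s₁` have strictly increasing x-coordinates. -/
def ConcaveChain (xL xR : ℕ → ℝ) (ls : List ℕ) : Prop :=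
  ∀ k, k + 3 ≤ ls.length → ∀ z w : ℝ × ℝ,
    z ∈ Seg (xL (ls.getD (k + 2) 0)) (xR (ls.getD (k + 2) 0)) ∩
        Seg (xL (ls.getD (k + 1) 0)) (xR (ls.getD (k + 1) 0)) →
    w ∈ Seg (xL (ls.getD (k + 1) 0)) (xR (ls.getD (k + 1) 0)) ∩
        Seg (xL (ls.getD k 0)) (xR (ls.getD k 0)) →
    z.1 < w.1

/-- The list of endpoint x-coordinates read along an endpoint sequence. -/
noncomputable def coordList (xL xR : ℕ → ℝ) (S : List ETok) : List ℝ :=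
  S.filterMap fun t =>
    match t with
    | ETok.L a => some (xL a)
    | ETok.R a => some (xR a)
    | _ => none

/-- The family of segments with endpoints on the parabola given by the endpoint
x-coordinates `xL`, `xR` realizes the endpoint sequence `S`: reading the endpoints
by increasing x-coordinate yields exactly `S` (in particular all endpoint
x-coordinates are pairwise distinct). -/
noncomputable def Realizes (xL xR : ℕ → ℝ) (S : List ETok) : Prop :=
  (coordList xL xR S).Chain' (· < ·)

/-! ### The configurations `F_m`, `Z_m`, `T_n`, `Y` and `X` -/

/-- The endpoint sequence `F_m = (L₁ ⋯ L_m) R₁ ⋯ R_m`, with one special block. -/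
def Fseq (m : ℕ) : List ETok :=
  ETok.op :: ((List.range' 1 m).map ETok.L) ++ ETok.cl :: ((List.range' 1 m).map ETok.R)

/-- The endpoint sequence
`Z_m = L_a L_b (L₁ ⋯ L_m) R₁ ⋯ R_m L_c R_a (L_{m+1} ⋯ L_{2m}) R_{m+1} ⋯ R_{2m} R_b R_c`,
with two special blocks.  The whisker labels are `a = 2m+1`, `b = 2m+2`, `c = 2m+3`,
and the numeric segments are labeled `1, …, 2m`. -/
def Zseq (m : ℕ) : List ETok :=
  ETok.L (2 * m + 1) :: ETok.L (2 * m + 2) ::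
    ETok.op :: ((List.range' 1 m).map ETok.L) ++ ETok.cl :: ((List.range' 1 m).map ETok.R) ++
    ETok.L (2 * m + 3) :: ETok.R (2 * m + 1) ::
    ETok.op :: ((List.range' (m + 1) m).map ETok.L) ++
    ETok.cl :: ((List.range' (m + 1) m).map ETok.R) ++
    [ETok.R (2 * m + 2), ETok.R (2 * m + 3)]

/-- The partial configurations `A_j = (⋯(Z₁ ∘ Z₂) ∘ ⋯ ) ∘ Z_{2^j}`. -/
def Aseq : ℕ → List ETok
  | 0 => Zseq 1
  | j + 1 => eshuffle (Aseq j) (Zseq (2 ^ (j + 1)))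

/-- The configuration `T_n = (⋯(((Z₁ ∘ Z₂) ∘ Z₄) ∘ Z₈) ∘ ⋯ ∘ Z_{2^{n−1}}) ∘ F_{2^n}`. -/
def Tseq (n : ℕ) : List ETok := eshuffle (Aseq (n - 1)) (Fseq (2 ^ n))

/-- The label triples `(a, b, c)` of the whiskers of `A_j`, tracked through the
relabelings performed by the endpoint shuffles. -/
def AWhiskers : ℕ → Set (ℕ × ℕ × ℕ)
  | 0 => {(3, 4, 5)}
  | j + 1 =>
      {(glob (2 * 2 ^ (j + 1) + 1), glob (2 * 2 ^ (j + 1) + 2), glob (2 * 2 ^ (j + 1) + 3))} ∪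
      {w | ∃ i < 2, ∃ t ∈ AWhiskers j, w = (loc i t.1, loc i t.2.1, loc i t.2.2)}

/-- The label triples `(a, b, c)` of the whiskers of `T_n`. -/
def TWhiskers (n : ℕ) : Set (ℕ × ℕ × ℕ) :=
  {w | ∃ t ∈ AWhiskers (n - 1), w = (loc 0 t.1, loc 0 t.2.1, loc 0 t.2.2)}

/-- The endpoint sequence `Y = L_d L_e ( ) ( ) L_f R_d ( ) ( ) R_e R_f ( )`,
with five empty special blocks; the labels are `d = 1`, `e = 2`, `f = 3`. -/
def Yseq : List ETok :=
  [ETok.L 1, ETok.L 2, ETok.op, ETok.cl, ETok.op, ETok.cl, ETok.L 3, ETok.R 1,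
   ETok.op, ETok.cl, ETok.op, ETok.cl, ETok.R 2, ETok.R 3, ETok.op, ETok.cl]

/-- The configuration `X = Y ∘ T₄` of 173 segments. -/
def Xseq : List ETok := eshuffle Yseq (Tseq 4)

/-! ### Concavity as a polynomial inequality -/

/-- Two crossing chords of the parabola meet, and the abscissa of the common point
is the one at which their supporting lines agree. -/
theorem exists_mem_seg_inter {a b a' b' : ℝ} (hab : a < b) (hba' : b < a') (hab' : a' < b') :
    ∃ z ∈ Seg a a' ∩ Seg b b', z.1 * (b + b' - a - a') = b * b' - a * a' := by
  have hD : 0 < b + b' - a - a' := by linarith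
  have key : ∀ u v x : ℝ, u < v → u ≤ x → x ≤ v →
      (x, (u + v) * x - u * v) ∈ Seg u v := by
    intro u v x huv hux hxv
    have h0 : 0 < v - u := by linarith
    refine ⟨(v - x) / (v - u), (x - u) / (v - u), div_nonneg (by linarith) h0.le,
      div_nonneg (by linarith) h0.le, ?_, ?_⟩
    · field_simp
      ring
    · ext
      · simp only [Ppt, Prod.fst_add, Prod.smul_fst, smul_eq_mul]
        field_simp
        ring
      · simp only [Ppt, Prod.snd_add, Prod.smul_snd, smul_eq_mul]
        field_simp
        ring
  set x := (b * b' - a * a') / (b + b' - a - a') with hx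
  have hxD : x * (b + b' - a - a') = b * b' - a * a' := div_mul_cancel₀ _ hD.ne'
  have hbx : b ≤ x := by
    rw [hx, le_div_iff₀ hD]
    nlinarith [mul_nonneg (sub_nonneg.2 hab.le) (sub_nonneg.2 hba'.le)]
  have hxa : x ≤ a' := by
    rw [hx, div_le_iff₀ hD]
    nlinarith [mul_nonneg (sub_nonneg.2 hab'.le) (sub_nonneg.2 hba'.le)]
  refine ⟨(x, (a + a') * x - a * a'), ⟨key a a' x (by linarith) (by linarith) hxa, ?_⟩, hxD⟩
  have h := key b b' x (by linarith) hbx (by linarith)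
  rwa [show (b + b') * x - b * b' = (a + a') * x - a * a' by linarith] at h

/-- If the crossing points of three pairwise crossing chords come in concave order, the
six endpoints satisfy a strict Ceva-type inequality. -/
theorem ceva_lt_of_concave {a b c a' b' c' : ℝ} (hab : a < b) (hbc : b < c) (hca' : c < a')
    (hab' : a' < b') (hbc' : b' < c')
    (h : ∀ z w : ℝ × ℝ, z ∈ Seg c c' ∩ Seg b b' → w ∈ Seg b b' ∩ Seg a a' → z.1 < w.1) :
    (c - b) * (b' - a') * (c' - a) < (b - a) * (a' - c) * (c' - b') := by
  obtain ⟨w, hw, hwx⟩ := exists_mem_seg_inter hab (hbc.trans hca') hab'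
  obtain ⟨z, hz, hzx⟩ := exists_mem_seg_inter hbc (hca'.trans hab') hbc'
  have hzw := h z w hz.symm hw.symm
  have h1 : 0 < b + b' - a - a' := by linarith
  have h2 : 0 < c + c' - b - b' := by linarith
  have h3 := mul_lt_mul_of_pos_right hzw (mul_pos h1 h2)
  have h4 : z.1 * ((b + b' - a - a') * (c + c' - b - b')) =
      (c * c' - b * b') * (b + b' - a - a') := by rw [← hzx]; ring
  have h5 : w.1 * ((b + b' - a - a') * (c + c' - b - b')) =
      (b * b' - a * a') * (c + c' - b - b') := by rw [← hwx]; ring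
  rw [h4, h5] at h3
  linarith

/-- In a concave whisker `L_a L_b ⋯ L_c R_a ⋯ R_b R_c`, either the gap between `L_c` and
`R_a` exceeds the one between `L_b` and `L_c`, or the gap between `R_b` and `R_c` exceeds
the one between `R_a` and `R_b`. -/
theorem whisker_gap {a b c a' b' c' : ℝ} (hab : a < b) (hbc : b < c) (hca' : c < a')
    (hab' : a' < b') (hbc' : b' < c')
    (h : (c - b) * (b' - a') * (c' - a) < (b - a) * (a' - c) * (c' - b')) :
    c - b < a' - c ∨ b' - a' < c' - b' := by
  by_contra! hcon
  have h1 : (a' - c) * (c' - b') ≤ (c - b) * (b' - a') :=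
    mul_le_mul hcon.1 hcon.2 (by linarith) (by linarith)
  have h2 : (b - a) * ((a' - c) * (c' - b')) ≤ (c' - a) * ((c - b) * (b' - a')) :=
    mul_le_mul (by linarith) h1 (mul_nonneg (by linarith) (by linarith)) (by linarith)
  linarith

/-- The constraint on the right endpoints of a group of five numeric segments that is
imposed by the concavity of the group and of the copy of `Y` interleaved with it. -/
theorem leaf_gap {d e f d' e' f' l₁ l₂ l₃ l₄ l₅ r₁ r₂ r₃ r₄ r₅ : ℝ}
    (hde : d < e) (he : e < l₁) (h12 : l₁ < l₂) (h2f : l₂ < f) (hf : f < d') (hd3 : d' < l₃)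
    (h34 : l₃ < l₄) (h4e : l₄ < e') (hef : e' < f') (hf5 : f' < l₅) (h5r : l₅ < r₁)
    (hr12 : r₁ < r₂) (hr23 : r₂ < r₃) (hr34 : r₃ < r₄) (hr45 : r₄ < r₅)
    (hY : (f - e) * (e' - d') * (f' - d) < (e - d) * (d' - f) * (f' - e'))
    (h123 : (l₃ - l₂) * (r₂ - r₁) * (r₃ - l₁) < (l₂ - l₁) * (r₁ - l₃) * (r₃ - r₂))
    (h345 : (l₅ - l₄) * (r₄ - r₃) * (r₅ - l₃) < (l₄ - l₃) * (r₃ - l₅) * (r₅ - r₄)) :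
    (r₂ - r₁) * (r₄ - r₃) < (r₁ - l₃) * (r₃ - r₂) := by
  have hl : (l₂ - l₁) * (l₄ - l₃) < (l₃ - l₂) * (l₅ - l₄) := by
    have h1 : (l₂ - l₁) * (l₄ - l₃) ≤ (f - e) * (e' - d') :=
      mul_le_mul (by linarith) (by linarith) (by linarith) (by linarith)
    have h2 : (d' - f) * (f' - e') ≤ (l₃ - l₂) * (l₅ - l₄) :=
      mul_le_mul (by linarith) (by linarith) (by linarith) (by linarith)
    have h3 : (f - e) * (e' - d') < (d' - f) * (f' - e') := by
      by_contra! hcon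
      have := mul_le_mul (show e - d ≤ f' - d by linarith) hcon
        (mul_nonneg (by linarith) (by linarith)) (by linarith)
      linarith
    linarith
  by_contra! hcon
  have k1 : (l₃ - l₂) * ((r₂ - r₁) * (r₃ - l₁)) * ((l₅ - l₄) * ((r₄ - r₃) * (r₅ - l₃))) <
      (l₂ - l₁) * (r₁ - l₃) * (r₃ - r₂) * ((l₄ - l₃) * (r₃ - l₅) * (r₅ - r₄)) := by
    have hp : ∀ {x y z : ℝ}, 0 < x → 0 < y → 0 < z → 0 ≤ x * y * z :=
      fun hx hy hz => (mul_pos (mul_pos hx hy) hz).le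
    have := mul_lt_mul'' h123 h345
      (hp (by linarith) (by linarith) (by linarith)) (hp (by linarith) (by linarith) (by linarith))
    linarith
  have k2 : (r₃ - l₅) * (r₅ - r₄) ≤ (r₃ - l₁) * (r₅ - l₃) :=
    mul_le_mul (by linarith) (by linarith) (by linarith) (by linarith)
  have k3 : (l₂ - l₁) * (l₄ - l₃) * ((r₁ - l₃) * (r₃ - r₂)) ≤
      (l₃ - l₂) * (l₅ - l₄) * ((r₂ - r₁) * (r₄ - r₃)) :=
    mul_le_mul hl.le hcon (mul_nonneg (by linarith) (by linarith))
      (mul_nonneg (by linarith) (by linarith))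
  have k4 := mul_le_mul k3 k2 (mul_nonneg (by linarith) (by linarith))
    (mul_nonneg (mul_nonneg (by linarith) (by linarith))
      (mul_nonneg (by linarith) (by linarith)))
  linarith

theorem realizes_iff {xL xR : ℕ → ℝ} {S : List ETok} :
    Realizes xL xR S ↔ (coordList xL xR S).IsChain (· < ·) :=
  Iff.rfl

/-- Along a subsequence of a realized endpoint sequence the coordinates increase. -/
theorem Realizes.sublist {xL xR : ℕ → ℝ} {S S' : List ETok} (h : Realizes xL xR S)
    (hs : S'.Sublist S) : Realizes xL xR S' :=
  List.IsChain.sublist h (hs.filterMap _)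

/-! ### Four groups of numeric segments of `X`

The leftmost whisker joining eight groups has two halves `i = 0, 1` of four groups each; the
leftmost whisker joining two groups within half `i` has the two sides `j = 0, 1`. -/

/-- The labels in `T₄` of the numeric segments in the group on side `j` of half `i`. -/
def groupLabels (i j : ℕ) : List ℕ :=
  [loc 0 (loc 0 (loc i (loc 0 (j + 1)))), loc 0 (loc 0 (loc i (glob (j + 1)))),
    loc 0 (loc 0 (glob (4 * i + j + 1))), loc 0 (glob (4 * i + j + 1)), glob (4 * i + j + 1)]

/-- The label in `X` of the numeric segment of level `k` in the group on side `j` of half `i`. -/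
def numLabel (i j k : ℕ) : ℕ := glob ((groupLabels i j).getD k 0)

/-- The labels of the whisker joining the two halves: `s = 1, 2, 3` for `a, b, c`. -/
def outerLabel (s : ℕ) : ℕ := glob (loc 0 (loc 0 (glob (8 + s))))

/-- The labels of the whisker joining the two sides of half `i`: `s = 1, 2, 3` for `a, b, c`. -/
def innerLabel (i s : ℕ) : ℕ := glob (loc 0 (loc 0 (loc i (loc 0 (2 + s)))))

/-- The endpoints of the group on side `j` of half `i`, interleaved with its copy of `Y`, up to
the first right endpoint of the group. -/
def groupSeq (i j : ℕ) : List ETok :=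
  [ETok.L (loc (4 * i + j) 1), ETok.L (loc (4 * i + j) 2), ETok.L (numLabel i j 0),
    ETok.L (numLabel i j 1), ETok.L (loc (4 * i + j) 3), ETok.R (loc (4 * i + j) 1),
    ETok.L (numLabel i j 2), ETok.L (numLabel i j 3), ETok.R (loc (4 * i + j) 2),
    ETok.R (loc (4 * i + j) 3), ETok.L (numLabel i j 4), ETok.R (numLabel i j 0)]

/-- The endpoints of the whisker with labels `w 1, w 2, w 3`, with the sequence `S` inserted on
its side `j`. -/
def whiskerSeq (w : ℕ → ℕ) (j : ℕ) (S : List ETok) : List ETok :=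
  ETok.L (w 1) :: ETok.L (w 2) :: ((if j = 0 then S else []) ++ ETok.L (w 3) :: ETok.R (w 1) ::
    ((if j = 0 then [] else S) ++ [ETok.R (w 2), ETok.R (w 3)]))

/-- The part of `X` that is relevant for the group on side `j` of half `i`. -/
def partSeq (i j : ℕ) : List ETok :=
  whiskerSeq outerLabel i (whiskerSeq (innerLabel i) j (groupSeq i j) ++
    [ETok.R (numLabel i j 1), ETok.R (numLabel i j 2)]) ++
  [ETok.R (numLabel i j 3), ETok.R (numLabel i j 4)]

theorem partSeq_sublist : ∀ i < 2, ∀ j < 2, (partSeq i j).Sublist Xseq := by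
  decide +kernel

theorem groupSeq_append_sublist : ∀ i < 2, ∀ j < 2,
    (groupSeq i j ++ [ETok.R (numLabel i j 1), ETok.R (numLabel i j 2), ETok.R (numLabel i j 3),
      ETok.R (numLabel i j 4)]).Sublist Xseq := by
  decide +kernel

theorem groupLabels_isInfix : ∀ i < 2, ∀ j < 2,
    (ETok.op :: (groupLabels i j).map ETok.L ++ [ETok.cl]) <:+: Tseq 4 := by
  decide +kernel

/-- In any realization of `X` the endpoints listed in `partSeq i j` come in that order. -/
theorem Realizes.partSeq {xL xR : ℕ → ℝ} (h : Realizes xL xR Xseq) {i j : ℕ} (hi : i < 2)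
    (hj : j < 2) : Realizes xL xR (partSeq i j) :=
  h.sublist (partSeq_sublist i hi j hj)

theorem outerLabel_mem :
    ∃ t ∈ TWhiskers 4, [glob t.1, glob t.2.1, glob t.2.2] =
      [outerLabel 1, outerLabel 2, outerLabel 3] :=
  ⟨_, ⟨_, Or.inr ⟨0, two_pos, _, Or.inl rfl, rfl⟩, rfl⟩, rfl⟩

theorem innerLabel_mem {i : ℕ} (hi : i < 2) :
    ∃ t ∈ TWhiskers 4, [glob t.1, glob t.2.1, glob t.2.2] =
      [innerLabel i 1, innerLabel i 2, innerLabel i 3] :=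
  ⟨_, ⟨_, Or.inr ⟨0, two_pos, _, Or.inr ⟨i, hi, _, Or.inr ⟨0, two_pos, _, rfl, rfl⟩, rfl⟩, rfl⟩,
    rfl⟩, rfl⟩

/-- In some half, the gap between the right endpoints of levels `2` and `3` exceeds the one
between levels `1` and `2`. -/
theorem exists_half {xL xR : ℕ → ℝ} (h : Realizes xL xR Xseq)
    (hc : ConcaveChain xL xR [outerLabel 1, outerLabel 2, outerLabel 3]) :
    ∃ i < 2, ∀ j < 2, xR (numLabel i j 2) - xR (numLabel i j 1) <
      xR (numLabel i j 3) - xR (numLabel i j 2) := by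
  have h00 := h.partSeq two_pos two_pos
  have h01 := h.partSeq two_pos one_lt_two
  have h10 := h.partSeq one_lt_two two_pos
  have h11 := h.partSeq one_lt_two one_lt_two
  simp [realizes_iff, coordList, _root_.partSeq, whiskerSeq, groupSeq] at h00 h01 h10 h11
  have hg := whisker_gap (a := xL (outerLabel 1)) (b := xL (outerLabel 2))
    (c := xL (outerLabel 3)) (a' := xR (outerLabel 1)) (b' := xR (outerLabel 2))
    (c' := xR (outerLabel 3)) (by linarith) (by linarith) (by linarith) (by linarith)
    (by linarith) (ceva_lt_of_concave (by linarith) (by linarith) (by linarith) (by linarith)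
      (by linarith) (hc 0 le_rfl))
  rcases hg with hg | hg
  · refine ⟨0, two_pos, fun j hj => ?_⟩
    interval_cases j <;> linarith
  · refine ⟨1, one_lt_two, fun j hj => ?_⟩
    interval_cases j <;> linarith

/-- On some side of a half, the gap between the right endpoints of levels `0` and `1` exceeds
the one between the left endpoint of level `2` and the right endpoint of level `0`. -/
theorem exists_side {xL xR : ℕ → ℝ} (h : Realizes xL xR Xseq) {i : ℕ} (hi : i < 2)
    (hc : ConcaveChain xL xR [innerLabel i 1, innerLabel i 2, innerLabel i 3]) :
    ∃ j < 2, xR (numLabel i j 0) - xL (numLabel i j 2) <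
      xR (numLabel i j 1) - xR (numLabel i j 0) := by
  have h0 := h.partSeq hi two_pos
  have h1 := h.partSeq hi one_lt_two
  have hg : _ ∨ _ := whisker_gap (a := xL (innerLabel i 1)) (b := xL (innerLabel i 2))
    (c := xL (innerLabel i 3)) (a' := xR (innerLabel i 1)) (b' := xR (innerLabel i 2))
    (c' := xR (innerLabel i 3)) ?_ ?_ ?_ ?_ ?_ (ceva_lt_of_concave ?_ ?_ ?_ ?_ ?_ (hc 0 le_rfl))
  · rcases hg with hg | hg
    · refine ⟨0, two_pos, ?_⟩
      interval_cases i <;>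
      · simp [realizes_iff, coordList, _root_.partSeq, whiskerSeq, groupSeq] at h0
        linarith
    · refine ⟨1, one_lt_two, ?_⟩
      interval_cases i <;>
      · simp [realizes_iff, coordList, _root_.partSeq, whiskerSeq, groupSeq] at h1
        linarith
  all_goals
    interval_cases i <;>
    · simp [realizes_iff, coordList, _root_.partSeq, whiskerSeq, groupSeq] at h0
      linarith

/-- Theorem `thm_forbidden_2`: the configuration `X = Y ∘ T₄` of 173 segments
cannot be realized by segments with all endpoints on the parabola `y = x²` in such
a way that simultaneously (i) in each of the 15 whiskers the three segments
`a, b, c` intersect concavely, (ii) in each of the 16 copies of `Y` the three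
segments `d, e, f` intersect concavely, and (iii) in each of the 16 groups of
numeric segments the five numeric segments intersect concavely.  (The whiskers and
numeric groups of `X` carry the labels they inherit from `T₄`, relabeled by `glob`
since `T₄` is the global sequence in `X = Y ∘ T₄`; the copies of `Y` are indexed by
`i < 16` and carry labels `loc i 1, loc i 2, loc i 3`; the `i`-th group of numeric
segments consists of the symbols of the `i`-th special block of `T₄`, relabeled by
`glob`.) -/
theorem thm_forbidden_2 (xL xR : ℕ → ℝ) (hreal : Realizes xL xR Xseq)
    (hwhisk : ∀ t ∈ TWhiskers 4, ConcaveChain xL xR [glob t.1, glob t.2.1, glob t.2.2])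
    (hY : ∀ i < 16, ConcaveChain xL xR [loc i 1, loc i 2, loc i 3])
    (hnum : ∀ (u : List ETok) (b : List ℕ) (v : List ETok),
      Tseq 4 = u ++ (ETok.op :: b.map ETok.L) ++ (ETok.cl :: v) →
      ConcaveChain xL xR (b.map glob)) :
    False := by
  obtain ⟨t, ht, hlab⟩ := outerLabel_mem
  obtain ⟨i, hi, houter⟩ := exists_half hreal (hlab ▸ hwhisk t ht)
  obtain ⟨t, ht, hlab⟩ := innerLabel_mem hi
  obtain ⟨j, hj, hinner⟩ := exists_side hreal hi (hlab ▸ hwhisk t ht)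
  have hgap := houter j hj
  have hsub : Realizes xL xR (groupSeq i j ++ [ETok.R (numLabel i j 1), ETok.R (numLabel i j 2),
      ETok.R (numLabel i j 3), ETok.R (numLabel i j 4)]) :=
    hreal.sublist (groupSeq_append_sublist i hi j hj)
  simp only [realizes_iff, coordList, groupSeq, List.cons_append, List.nil_append,
    List.filterMap_cons, List.filterMap_nil, List.isChain_cons_cons, List.isChain_singleton,
    and_true] at hsub
  have hYc := hY (4 * i + j) (by omega)
  obtain ⟨u, v, huv⟩ := groupLabels_isInfix i hi j hj
  have hN := hnum u (groupLabels i j) v (by simpa using huv.symm)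
  have hleaf := leaf_gap (d := xL (loc (4 * i + j) 1)) (e := xL (loc (4 * i + j) 2))
    (f := xL (loc (4 * i + j) 3)) (d' := xR (loc (4 * i + j) 1)) (e' := xR (loc (4 * i + j) 2))
    (f' := xR (loc (4 * i + j) 3)) (l₁ := xL (numLabel i j 0)) (l₂ := xL (numLabel i j 1))
    (l₃ := xL (numLabel i j 2)) (l₄ := xL (numLabel i j 3)) (l₅ := xL (numLabel i j 4))
    (r₁ := xR (numLabel i j 0)) (r₂ := xR (numLabel i j 1)) (r₃ := xR (numLabel i j 2))
    (r₄ := xR (numLabel i j 3)) (r₅ := xR (numLabel i j 4))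
    (by linarith) (by linarith) (by linarith) (by linarith) (by linarith) (by linarith)
    (by linarith) (by linarith) (by linarith) (by linarith) (by linarith) (by linarith)
    (by linarith) (by linarith) (by linarith)
    (ceva_lt_of_concave (by linarith) (by linarith) (by linarith) (by linarith) (by linarith)
      (hYc 0 le_rfl))
    (ceva_lt_of_concave (by linarith) (by linarith) (by linarith) (by linarith) (by linarith)
      (hN 0 (by simp [groupLabels])))
    (ceva_lt_of_concave (by linarith) (by linarith) (by linarith) (by linarith) (by linarith)
      (hN 2 (by simp [groupLabels])))
  have := mul_lt_mul'' hinner hgap (by linarith) (by linarith)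
  linarith
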